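/- arXiv:2203.00949 — 2 statements merged into one kernel-verified Lean document; each statement's English description precedes it below -/
import Mathlib

section
/- Let V be a finite set of nodes with a distinguished node q, let X : V → ℝ^d assign unit Euclidean norm vectors, and for each v ∈ V \ {q} let S_v ⊆ V be a finite in-neighborhood such that the number of v with q ∈ S_v is at most D. Let P be the law on (ℝ^d)^{V \ {q}} of the family (∑_{u ∈ S_v} X_u + Z_v)_{v ∈ V \ {q}}, and let P' be the law of (∑_{u ∈ S_v \ {q}} X_u + Z_v)_{v ∈ V \ {q}}, where the Z_v are independent random vectors with d independent N(0, σ²) coordinates. Then for every α > 1, the Rényi divergence of order α between P and P' is at most D·α/(2σ²). -/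
open MeasureTheory ProbabilityTheory
open scoped BigOperators

/-- The Rényi divergence of order `α` between measures `P` and `Q`:
`D_α(P‖Q) = (1/(α−1)) · log ∫ (dP/dQ)^α dQ`. -/
noncomputable def renyiDiv {Ω : Type*} [MeasurableSpace Ω] (α : ℝ)
    (P Q : Measure Ω) : ℝ :=
  (α - 1)⁻¹ * Real.log (∫ x, (P.rnDeriv Q x).toReal ^ α ∂Q)

theorem lintegral_pi_prod {ι : Type*} [Fintype ι] {Ω : ι → Type*}
    [∀ i, MeasurableSpace (Ω i)] (μ : ∀ i, Measure (Ω i)) [∀ i, IsProbabilityMeasure (μ i)]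
    {f : ∀ i, Ω i → ENNReal} (hf : ∀ i, Measurable (f i)) :
    ∫⁻ x, ∏ i, f i (x i) ∂Measure.pi μ = ∏ i, ∫⁻ x, f i x ∂μ i := by
  have h := lintegral_prod_eq_prod_lintegral_of_indepFun (μ := Measure.pi μ) Finset.univ
    (fun i (x : ∀ i, Ω i) => f i (x i)) (iIndepFun_pi fun i => (hf i).aemeasurable)
    (fun i => (hf i).comp (measurable_pi_apply i))
  rw [h]
  exact Finset.prod_congr rfl fun i _ => (measurePreserving_eval μ i).lintegral_comp (hf i)

theorem pi_eq_withDensity_prod_rnDeriv {ι : Type*} [Fintype ι] {Ω : ι → Type*}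
    [∀ i, MeasurableSpace (Ω i)] (ν μ : ∀ i, Measure (Ω i)) [∀ i, SigmaFinite (ν i)]
    [∀ i, IsProbabilityMeasure (μ i)] (h : ∀ i, ν i ≪ μ i) :
    Measure.pi ν = (Measure.pi μ).withDensity fun x => ∏ i, (ν i).rnDeriv (μ i) (x i) := by
  refine Measure.pi_eq fun s hs => ?_
  rw [withDensity_apply _ (MeasurableSet.univ_pi hs),
    ← lintegral_indicator (MeasurableSet.univ_pi hs)]
  have hprod : ((Set.univ.pi s).indicator fun x => ∏ i, (ν i).rnDeriv (μ i) (x i)) =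
      fun x => ∏ i, (s i).indicator ((ν i).rnDeriv (μ i)) (x i) := by
    classical
    ext x
    by_cases hx : x ∈ Set.univ.pi s
    · rw [Set.indicator_of_mem hx]
      exact Finset.prod_congr rfl fun i _ => (Set.indicator_of_mem (hx i trivial) _).symm
    · rw [Set.indicator_of_notMem hx]
      obtain ⟨i, hi⟩ : ∃ i, x i ∉ s i := by simpa [Set.mem_pi] using hx
      exact (Finset.prod_eq_zero (Finset.mem_univ i) (Set.indicator_of_notMem hi _)).symm
  rw [hprod, lintegral_pi_prod μ fun i => (Measure.measurable_rnDeriv _ _).indicator (hs i)]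
  refine Finset.prod_congr rfl fun i _ => ?_
  rw [lintegral_indicator (hs i), Measure.setLIntegral_rnDeriv (h i)]

theorem pi_absolutelyContinuous {ι : Type*} [Fintype ι] {Ω : ι → Type*}
    [∀ i, MeasurableSpace (Ω i)] {ν μ : ∀ i, Measure (Ω i)} [∀ i, SigmaFinite (ν i)]
    [∀ i, IsProbabilityMeasure (μ i)] (h : ∀ i, ν i ≪ μ i) :
    Measure.pi ν ≪ Measure.pi μ := by
  rw [pi_eq_withDensity_prod_rnDeriv ν μ h]
  exact withDensity_absolutelyContinuous _ _

theorem integral_rnDeriv_pi_rpow {ι : Type*} [Fintype ι] {Ω : ι → Type*}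
    [∀ i, MeasurableSpace (Ω i)] {ν μ : ∀ i, Measure (Ω i)} [∀ i, SigmaFinite (ν i)]
    [∀ i, IsProbabilityMeasure (μ i)] (h : ∀ i, ν i ≪ μ i) (α : ℝ) :
    ∫ x, ((Measure.pi ν).rnDeriv (Measure.pi μ) x).toReal ^ α ∂Measure.pi μ =
      ∏ i, ∫ x, ((ν i).rnDeriv (μ i) x).toReal ^ α ∂μ i := by
  have hderiv : (Measure.pi ν).rnDeriv (Measure.pi μ) =ᵐ[Measure.pi μ]
      fun x => ∏ i, (ν i).rnDeriv (μ i) (x i) := by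
    conv_lhs => rw [pi_eq_withDensity_prod_rnDeriv ν μ h]
    exact Measure.rnDeriv_withDensity _ (by fun_prop)
  rw [← integral_fintype_prod_eq_prod fun i x => ((ν i).rnDeriv (μ i) x).toReal ^ α]
  refine integral_congr_ae (hderiv.mono fun x hx => ?_)
  simp only [hx, ENNReal.toReal_prod]
  exact (Real.finsetProd_rpow _ _ (fun i _ => ENNReal.toReal_nonneg) α).symm

theorem gaussianReal_eq_withDensity_gaussianReal (a b : ℝ) {v : NNReal} (hv : v ≠ 0) :
    gaussianReal a v = (gaussianReal b v).withDensity fun x =>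
      ENNReal.ofReal (Real.exp (-(a ^ 2 - b ^ 2) / (2 * v) + (a - b) / v * x)) := by
  have hv' : (v : ℝ) ≠ 0 := by exact_mod_cast hv
  rw [gaussianReal_of_var_ne_zero a hv, gaussianReal_of_var_ne_zero b hv,
    ← withDensity_mul _ (measurable_gaussianPDF b v) (by fun_prop)]
  congr 1
  ext x
  rw [Pi.mul_apply, gaussianPDF, gaussianPDF, ← ENNReal.ofReal_mul (gaussianPDFReal_nonneg b v x),
    gaussianPDFReal, gaussianPDFReal, mul_assoc (√(2 * Real.pi * v))⁻¹, ← Real.exp_add]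
  congr 3
  field_simp
  ring

theorem integral_rnDeriv_gaussianReal_rpow (a b : ℝ) {v : NNReal} (hv : v ≠ 0) (α : ℝ) :
    ∫ x, ((gaussianReal a v).rnDeriv (gaussianReal b v) x).toReal ^ α ∂gaussianReal b v =
      Real.exp (α * (α - 1) / (2 * v) * (a - b) ^ 2) := by
  have hv' : (v : ℝ) ≠ 0 := by exact_mod_cast hv
  have hderiv : (gaussianReal a v).rnDeriv (gaussianReal b v) =ᵐ[gaussianReal b v] fun x =>
      ENNReal.ofReal (Real.exp (-(a ^ 2 - b ^ 2) / (2 * v) + (a - b) / v * x)) := by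
    conv_lhs => rw [gaussianReal_eq_withDensity_gaussianReal a b hv]
    exact Measure.rnDeriv_withDensity _ (by fun_prop)
  have hpow : (fun x => ((gaussianReal a v).rnDeriv (gaussianReal b v) x).toReal ^ α)
      =ᵐ[gaussianReal b v] fun x =>
        Real.exp (-(a ^ 2 - b ^ 2) / (2 * v) * α) * Real.exp ((a - b) / v * α * x) :=
    hderiv.mono fun x hx => by
      simp only [hx]
      rw [ENNReal.toReal_ofReal (Real.exp_nonneg _), ← Real.exp_mul, ← Real.exp_add]
      ring_nf
  have hmgf := congrFun (mgf_id_gaussianReal (μ := b) (v := v)) ((a - b) / v * α)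
  simp only [mgf, id] at hmgf
  rw [integral_congr_ae hpow, integral_const_mul, hmgf, ← Real.exp_add]
  congr 1
  field_simp
  ring

theorem map_const_add_pi_gaussianReal {ι κ : Type*} [Fintype ι] [Fintype κ] (m : ι → κ → ℝ)
    (v : NNReal) :
    Measure.map (fun (Z : ι → κ → ℝ) i j => m i j + Z i j)
        (Measure.pi fun _ => Measure.pi fun _ => gaussianReal 0 v) =
      Measure.pi fun i => Measure.pi fun j => gaussianReal (m i j) v := by
  have hrow (i : ι) : Measure.map (fun (z : κ → ℝ) j => m i j + z j)
      (Measure.pi fun _ => gaussianReal 0 v) = Measure.pi fun j => gaussianReal (m i j) v := by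
    rw [Measure.pi_map_pi (f := fun j x => m i j + x) fun j => by fun_prop]
    simp_rw [gaussianReal_map_const_add, zero_add]
  have (i : ι) : SigmaFinite (Measure.map (fun (z : κ → ℝ) j => m i j + z j)
      (Measure.pi fun _ => gaussianReal 0 v)) := by
    rw [hrow]
    infer_instance
  rw [Measure.pi_map_pi (f := fun i (z : κ → ℝ) j => m i j + z j)
    fun i => Measurable.aemeasurable (by fun_prop)]
  simp_rw [hrow]

theorem renyiDiv_pi_gaussianReal {ι κ : Type*} [Fintype ι] [Fintype κ] (a b : ι → κ → ℝ)
    {v : NNReal} (hv : v ≠ 0) {α : ℝ} (hα : α ≠ 1) :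
    renyiDiv α (Measure.pi fun i => Measure.pi fun j => gaussianReal (a i j) v)
        (Measure.pi fun i => Measure.pi fun j => gaussianReal (b i j) v) =
      α / (2 * v) * ∑ i, ∑ j, (a i j - b i j) ^ 2 := by
  have hac (x y : ℝ) : gaussianReal x v ≪ gaussianReal y v :=
    (gaussianReal_absolutelyContinuous x hv).trans (gaussianReal_absolutelyContinuous' y hv)
  rw [renyiDiv, integral_rnDeriv_pi_rpow fun i => pi_absolutelyContinuous fun j => hac _ _]
  simp_rw [integral_rnDeriv_pi_rpow fun j => hac _ _, integral_rnDeriv_gaussianReal_rpow _ _ hv,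
    ← Real.exp_sum, Real.log_exp, ← Finset.mul_sum]
  have := sub_ne_zero.mpr hα
  field_simp

/-- **Noisy sum aggregation on a degree-bounded graph is node-level `(α, Dα/(2σ²))`-RDP
(nonadaptive form).**
`V` is a finite set of nodes with a distinguished node `q`, each `X u` is a unit Euclidean
norm vector in `ℝ^d`, each node `v ≠ q` has in-neighborhood `S v ⊆ V`, and at most `D` of
these neighborhoods contain `q`. `P` is the law of the family
`(∑_{u ∈ S v} X u + Z v)_{v ≠ q}` and `P'` that of `(∑_{u ∈ S v \ {q}} X u + Z v)_{v ≠ q}`,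
where the `Z v` are independent with `d` independent `N(0, σ²)` coordinates. Then for every
`α > 1`, `D_α(P ‖ P') ≤ D·α/(2σ²)`. -/
theorem renyiDiv_noisy_sum_aggregation_node_level
    {V : Type*} [Fintype V] [DecidableEq V] (d D : ℕ) (σ : ℝ) (hσ : 0 < σ)
    (q : V) (X : V → Fin d → ℝ)
    (hX : ∀ u, Real.sqrt (∑ i, (X u i) ^ 2) = 1)
    (S : V → Finset V)
    (hD : (Finset.univ.filter fun v : V => v ≠ q ∧ q ∈ S v).card ≤ D)
    (α : ℝ) (hα : 1 < α) :
    renyiDiv α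
        (Measure.map
          (fun Z : {v : V // v ≠ q} → Fin d → ℝ =>
            fun v : {v : V // v ≠ q} => fun i => (∑ u ∈ S v.1, X u i) + Z v i)
          (Measure.pi fun _ : {v : V // v ≠ q} =>
            Measure.pi fun _ : Fin d => gaussianReal 0 ((σ ^ 2).toNNReal)))
        (Measure.map
          (fun Z : {v : V // v ≠ q} → Fin d → ℝ =>
            fun v : {v : V // v ≠ q} => fun i => (∑ u ∈ (S v.1).erase q, X u i) + Z v i)
          (Measure.pi fun _ : {v : V // v ≠ q} =>
            Measure.pi fun _ : Fin d => gaussianReal 0 ((σ ^ 2).toNNReal))) ≤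
      D * α / (2 * σ ^ 2) := by
  have hv : (σ ^ 2).toNNReal ≠ 0 := (Real.toNNReal_pos.mpr (by positivity)).ne'
  have hnorm : ∑ i, X q i ^ 2 = 1 := Real.sqrt_eq_one.mp (hX q)
  have hrow (v : V) :
      ∑ i, (∑ u ∈ S v, X u i - ∑ u ∈ (S v).erase q, X u i) ^ 2 = if q ∈ S v then 1 else 0 := by
    split_ifs with hq
    · simp_rw [← Finset.add_sum_erase (S v) (fun u => X u _) hq, add_sub_cancel_right, hnorm]
    · simp [Finset.erase_eq_of_notMem hq]
  have hcard : ∑ v : {v : V // v ≠ q}, (if q ∈ S v.1 then (1 : ℝ) else 0) ≤ D := by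
    rw [← Finset.sum_subtype (Finset.univ.filter fun v : V => v ≠ q) (by simp)
      fun v => if q ∈ S v then (1 : ℝ) else 0, Finset.sum_boole, Finset.filter_filter]
    exact_mod_cast hD
  rw [map_const_add_pi_gaussianReal fun (v : {v : V // v ≠ q}) i => ∑ u ∈ S v.1, X u i,
    map_const_add_pi_gaussianReal fun (v : {v : V // v ≠ q}) i => ∑ u ∈ (S v.1).erase q, X u i,
    renyiDiv_pi_gaussianReal _ _ hv hα.ne', Real.coe_toNNReal _ (sq_nonneg σ)]
  simp_rw [hrow]
  calc α / (2 * σ ^ 2) * ∑ v : {v : V // v ≠ q}, (if q ∈ S v.1 then (1 : ℝ) else 0)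
      ≤ α / (2 * σ ^ 2) * D := by gcongr
    _ = D * α / (2 * σ ^ 2) := by ring
end

section
/- Let V be a finite set of nodes with a distinguished node q, let D, K be positive integers, σ > 0, and let X^{(0)}, …, X^{(K−1)} : V → ℝ^d assign unit Euclidean norm vectors. For each v ∈ V \ {q} let S_v ⊆ V be a finite in-neighborhood such that the number of v with q ∈ S_v is at most D. Let P be the law of the tuple of K families ((∑_{u ∈ S_v} X^{(k)}_u + Z^{(k)}_v)_{v ∈ V \ {q}})_{k=0,…,K−1}, and P' the law of ((∑_{u ∈ S_v \ {q}} X^{(k)}_u + Z^{(k)}_v)_{v ∈ V \ {q}})_{k=0,…,K−1}, where all Z^{(k)}_v are independent random vectors with d independent N(0, σ²) coordinates. Then for every α > 1, the Rényi divergence of order α between P and P' is at most D·K·α/(2σ²). -/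
open MeasureTheory ProbabilityTheory
open scoped BigOperators

/-- `P` has a real density with respect to `Q` whose `α`-th moment under `Q` is `c`. -/
def HasDensityMoment {Ω : Type*} [MeasurableSpace Ω] (α : ℝ) (P Q : Measure Ω) (c : ℝ) : Prop :=
  ∃ g : Ω → ℝ, Measurable g ∧ (∀ x, 0 ≤ g x) ∧
    P = Q.withDensity (fun x => ENNReal.ofReal (g x)) ∧ ∫ x, g x ^ α ∂Q = c

theorem HasDensityMoment.renyiDiv_eq {Ω : Type*} [MeasurableSpace Ω] {α c : ℝ}
    {P Q : Measure Ω} [SigmaFinite Q] (h : HasDensityMoment α P Q c) :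
    renyiDiv α P Q = (α - 1)⁻¹ * Real.log c := by
  obtain ⟨g, hg, hg0, rfl, rfl⟩ := h
  rw [renyiDiv]
  congr 2
  refine integral_congr_ae ?_
  filter_upwards [Measure.rnDeriv_withDensity Q hg.ennreal_ofReal] with x hx
  rw [hx, ENNReal.toReal_ofReal (hg0 x)]

theorem pi_withDensity_ofReal {ι : Type*} [Fintype ι] {E : ι → Type*}
    [∀ i, MeasurableSpace (E i)] (Q : ∀ i, Measure (E i)) [∀ i, SigmaFinite (Q i)]
    {g : ∀ i, E i → ℝ} (hg0 : ∀ i x, 0 ≤ g i x) (hg : ∀ i, Integrable (g i) (Q i)) :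
    Measure.pi (fun i => (Q i).withDensity fun x => ENNReal.ofReal (g i x)) =
      (Measure.pi Q).withDensity fun x => ENNReal.ofReal (∏ i, g i (x i)) := by
  have (i : ι) : IsFiniteMeasure ((Q i).withDensity fun x => ENNReal.ofReal (g i x)) :=
    isFiniteMeasure_withDensity_ofReal (hg i).2
  refine Measure.pi_eq fun s hs => ?_
  rw [withDensity_apply _ (.univ_pi hs), Measure.restrict_pi_pi,
    ← ofReal_integral_eq_lintegral_ofReal
      (Integrable.fintype_prod_dep fun i => (hg i).restrict (s := s i))
      (.of_forall fun x => Finset.prod_nonneg fun i _ => hg0 i (x i)),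
    integral_fintype_prod_eq_prod,
    ENNReal.ofReal_prod_of_nonneg fun i _ => integral_nonneg (hg0 i)]
  refine Finset.prod_congr rfl fun i _ => ?_
  rw [withDensity_apply _ (hs i), ofReal_integral_eq_lintegral_ofReal (hg i).restrict
    (.of_forall (hg0 i))]

theorem HasDensityMoment.pi {ι : Type*} [Fintype ι] {E : ι → Type*}
    [∀ i, MeasurableSpace (E i)] {α : ℝ} {P Q : ∀ i, Measure (E i)} {c : ι → ℝ}
    [∀ i, IsFiniteMeasure (P i)] [∀ i, SigmaFinite (Q i)]
    (h : ∀ i, HasDensityMoment α (P i) (Q i) (c i)) :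
    HasDensityMoment α (Measure.pi P) (Measure.pi Q) (∏ i, c i) := by
  choose g hg hg0 hP hc using h
  have hint (i : ι) : Integrable (g i) (Q i) := by
    refine ⟨(hg i).aestronglyMeasurable, ?_⟩
    rw [hasFiniteIntegral_iff_ofReal (.of_forall (hg0 i)), ← setLIntegral_univ,
      ← withDensity_apply _ .univ, ← hP i]
    exact measure_lt_top _ _
  refine ⟨fun x => ∏ i, g i (x i), by fun_prop,
    fun x => Finset.prod_nonneg fun i _ => hg0 i (x i), ?_, ?_⟩
  · rw [← pi_withDensity_ofReal Q hg0 hint]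
    exact congrArg Measure.pi (funext hP)
  · simp_rw [← hc, ← integral_fintype_prod_eq_prod (f := fun i x => g i x ^ α),
      Real.finsetProd_rpow _ _ fun i _ => hg0 i _]

theorem hasDensityMoment_gaussianReal (α m m' : ℝ) {v : NNReal} (hv : v ≠ 0) :
    HasDensityMoment α (gaussianReal m v) (gaussianReal m' v)
      (Real.exp (α * (α - 1) * (m - m') ^ 2 / (2 * v))) := by
  have hv' : (v : ℝ) ≠ 0 := by exact_mod_cast hv
  refine ⟨fun x => Real.exp ((m - m') / v * (x - m') - (m - m') ^ 2 / (2 * v)), by fun_prop,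
    fun x => (Real.exp_pos _).le, ?_, ?_⟩
  · rw [gaussianReal_of_var_ne_zero _ hv, gaussianReal_of_var_ne_zero _ hv,
      ← withDensity_mul _ (measurable_gaussianPDF _ _) (by fun_prop)]
    congr 1
    ext x
    rw [Pi.mul_apply, gaussianPDF, gaussianPDF,
      ← ENNReal.ofReal_mul (gaussianPDFReal_nonneg _ _ _), gaussianPDFReal, gaussianPDFReal,
      mul_assoc _ (Real.exp _), ← Real.exp_add]
    congr 3
    field_simp
    ring
  · have key (x : ℝ) :
        Real.exp ((m - m') / v * (x - m') - (m - m') ^ 2 / (2 * v)) ^ α =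
          Real.exp (α * (m - m') / v * x) *
            Real.exp (-(α * (m - m') / v * m') - α * (m - m') ^ 2 / (2 * v)) := by
      rw [← Real.exp_mul, ← Real.exp_add]
      congr 1
      ring
    have hmgf := congrFun (mgf_fun_id_gaussianReal (μ := m') (v := v)) (α * (m - m') / v)
    rw [mgf] at hmgf
    simp_rw [key]
    rw [integral_mul_const, hmgf, ← Real.exp_add]
    congr 1
    field_simp
    ring

theorem map_translate_pi_pi_pi_gaussianReal {ι κ τ : Type*} [Fintype ι] [Fintype κ] [Fintype τ]
    (m : ι → κ → τ → ℝ) (v : NNReal) :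
    Measure.map (fun (Z : ι → κ → τ → ℝ) i j l => m i j l + Z i j l)
        (Measure.pi fun _ => Measure.pi fun _ => Measure.pi fun _ => gaussianReal 0 v) =
      Measure.pi fun i => Measure.pi fun j => Measure.pi fun l => gaussianReal (m i j l) v := by
  have h₁ (i : ι) (j : κ) :
      Measure.map (fun (z : τ → ℝ) l => m i j l + z l) (Measure.pi fun _ => gaussianReal 0 v) =
        Measure.pi fun l => gaussianReal (m i j l) v := by
    have (l : τ) : IsProbabilityMeasure ((gaussianReal 0 v).map (m i j l + ·)) :=
      Measure.isProbabilityMeasure_map (by fun_prop)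
    rw [Measure.pi_map_pi (f := fun l x => m i j l + x) fun l => by fun_prop]
    simp_rw [gaussianReal_map_const_add, zero_add]
  have h₂ (i : ι) :
      Measure.map (fun (z : κ → τ → ℝ) j l => m i j l + z j l)
          (Measure.pi fun _ => Measure.pi fun _ => gaussianReal 0 v) =
        Measure.pi fun j => Measure.pi fun l => gaussianReal (m i j l) v := by
    have (j : κ) : IsProbabilityMeasure (Measure.map (fun (z : τ → ℝ) l => m i j l + z l)
        (Measure.pi fun _ => gaussianReal 0 v)) :=
      Measure.isProbabilityMeasure_map
        (by fun_prop : Measurable fun (z : τ → ℝ) l => m i j l + z l).aemeasurable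
    rw [Measure.pi_map_pi (f := fun j (z : τ → ℝ) l => m i j l + z l) fun j =>
      (by fun_prop : Measurable fun (z : τ → ℝ) l => m i j l + z l).aemeasurable]
    simp_rw [h₁]
  have (i : ι) : IsProbabilityMeasure (Measure.map (fun (z : κ → τ → ℝ) j l => m i j l + z j l)
      (Measure.pi fun _ => Measure.pi fun _ => gaussianReal 0 v)) :=
    Measure.isProbabilityMeasure_map
      (by fun_prop : Measurable fun (z : κ → τ → ℝ) j l => m i j l + z j l).aemeasurable
  rw [Measure.pi_map_pi (f := fun i (z : κ → τ → ℝ) j l => m i j l + z j l)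
    fun i =>
      (by fun_prop : Measurable fun (z : κ → τ → ℝ) j l => m i j l + z j l).aemeasurable]
  simp_rw [h₂]

theorem renyiDiv_map_translate_gaussianReal {ι κ τ : Type*} [Fintype ι] [Fintype κ] [Fintype τ]
    {α : ℝ} (hα : 1 < α) (m m' : ι → κ → τ → ℝ) {v : NNReal} (hv : v ≠ 0) :
    renyiDiv α
        (Measure.map (fun (Z : ι → κ → τ → ℝ) i j l => m i j l + Z i j l)
          (Measure.pi fun _ => Measure.pi fun _ => Measure.pi fun _ => gaussianReal 0 v))
        (Measure.map (fun (Z : ι → κ → τ → ℝ) i j l => m' i j l + Z i j l)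
          (Measure.pi fun _ => Measure.pi fun _ => Measure.pi fun _ => gaussianReal 0 v)) =
      α / (2 * v) * ∑ i, ∑ j, ∑ l, (m i j l - m' i j l) ^ 2 := by
  rw [map_translate_pi_pi_pi_gaussianReal, map_translate_pi_pi_pi_gaussianReal,
    (HasDensityMoment.pi fun i => .pi fun j => .pi fun l =>
      hasDensityMoment_gaussianReal α (m i j l) (m' i j l) hv).renyiDiv_eq]
  simp_rw [← Real.exp_sum, Real.log_exp, Finset.mul_sum]
  have : α - 1 ≠ 0 := by linarith
  refine Finset.sum_congr rfl fun i _ => Finset.sum_congr rfl fun j _ =>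
    Finset.sum_congr rfl fun l _ => ?_
  field_simp

/-- **PMA on a degree-bounded graph is node-level `(α, DKα/(2σ²))`-RDP (nonadaptive form).**
`V` is a finite set of nodes with a distinguished node `q`; each `X k u` (for hop
`k < K`) is a unit Euclidean norm vector in `ℝ^d`; each node `v ≠ q` has in-neighborhood
`S v ⊆ V`, at most `D` of which contain `q`. `P` is the law of the `K` families
`((∑_{u ∈ S v} X k u + Z k v)_{v ≠ q})_{k < K}` and `P'` that of
`((∑_{u ∈ S v \ {q}} X k u + Z k v)_{v ≠ q})_{k < K}`, where all `Z k v` are independent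
with `d` independent `N(0, σ²)` coordinates. Then for every `α > 1`,
`D_α(P ‖ P') ≤ D·K·α/(2σ²)`. -/
theorem renyiDiv_private_multihop_aggregation_node_level
    {V : Type*} [Fintype V] [DecidableEq V] (d D K : ℕ) (hD : 0 < D) (hK : 0 < K)
    (σ : ℝ) (hσ : 0 < σ) (q : V)
    (X : Fin K → V → Fin d → ℝ)
    (hX : ∀ k u, Real.sqrt (∑ i, (X k u i) ^ 2) = 1)
    (S : V → Finset V)
    (hdeg : (Finset.univ.filter fun v : V => v ≠ q ∧ q ∈ S v).card ≤ D)
    (α : ℝ) (hα : 1 < α) :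
    renyiDiv α
        (Measure.map
          (fun Z : Fin K → {v : V // v ≠ q} → Fin d → ℝ =>
            fun (k : Fin K) (v : {v : V // v ≠ q}) (i : Fin d) =>
              (∑ u ∈ S v.1, X k u i) + Z k v i)
          (Measure.pi fun _ : Fin K => Measure.pi fun _ : {v : V // v ≠ q} =>
            Measure.pi fun _ : Fin d => gaussianReal 0 ((σ ^ 2).toNNReal)))
        (Measure.map
          (fun Z : Fin K → {v : V // v ≠ q} → Fin d → ℝ =>
            fun (k : Fin K) (v : {v : V // v ≠ q}) (i : Fin d) =>
              (∑ u ∈ (S v.1).erase q, X k u i) + Z k v i)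
          (Measure.pi fun _ : Fin K => Measure.pi fun _ : {v : V // v ≠ q} =>
            Measure.pi fun _ : Fin d => gaussianReal 0 ((σ ^ 2).toNNReal))) ≤
      D * K * α / (2 * σ ^ 2) := by
  have hv : (σ ^ 2).toNNReal ≠ 0 := by
    simpa using hσ.ne'
  have hsq (k : Fin K) (u : V) : ∑ i, X k u i ^ 2 = 1 := Real.sqrt_eq_one.mp (hX k u)
  have hdiff (k : Fin K) (v : V) :
      ∑ i, ((∑ u ∈ S v, X k u i) - ∑ u ∈ (S v).erase q, X k u i) ^ 2 =
        if q ∈ S v then 1 else 0 := by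
    split_ifs with h
    · simp_rw [← Finset.add_sum_erase _ _ h, add_sub_cancel_right, hsq]
    · simp [Finset.erase_eq_of_notMem h]
  have hcard : ∑ v : {v : V // v ≠ q}, (if q ∈ S v.1 then (1 : ℝ) else 0) ≤ D := by
    have hsub := Finset.sum_subtype (Finset.univ.filter fun v : V => v ≠ q)
      (p := fun v => v ≠ q) (F := inferInstance) (by simp) fun v => if q ∈ S v then (1 : ℝ) else 0
    rw [← hsub, Finset.sum_boole, Finset.filter_filter]
    exact_mod_cast hdeg
  rw [renyiDiv_map_translate_gaussianReal hα
    (fun k (v : {v : V // v ≠ q}) i => ∑ u ∈ S v.1, X k u i)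
    (fun k (v : {v : V // v ≠ q}) i => ∑ u ∈ (S v.1).erase q, X k u i) hv,
    Real.coe_toNNReal _ (sq_nonneg σ)]
  simp_rw [hdiff, Finset.sum_const, Finset.card_univ, Fintype.card_fin, nsmul_eq_mul]
  calc α / (2 * σ ^ 2) * (K * ∑ v : {v : V // v ≠ q}, if q ∈ S v.1 then (1 : ℝ) else 0)
      ≤ α / (2 * σ ^ 2) * (K * D) := by gcongr
    _ = D * K * α / (2 * σ ^ 2) := by ring
end
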